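/- arXiv:1306.2751 — 11 statements merged into one kernel-verified Lean document; each statement's English description precedes it below -/
import Mathlib

section
/- Let p < 1, p ≠ 0, and let U : (0,∞) → ℝ be increasing, concave, and differentiable on (M₀,∞) for some M₀ > 0, with lim_{x→∞} U'(x)/x^{p-1} = 1; in the case p < 0 assume additionally lim_{x→∞} U(x) = 0. Then U is regularly varying at infinity with index p, i.e., lim_{x→∞} U(cx)/U(x) = c^p for every c > 0. -/
open Filter Topology Set

/-- L'Hôpital's rule at `+∞` for a denominator tending to `+∞`. -/
theorem HasDerivAt.lhopital_atTop_atTop {f f' g g' : ℝ → ℝ} {l : ℝ}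
    (hf : ∀ᶠ x in atTop, HasDerivAt f (f' x) x)
    (hg : ∀ᶠ x in atTop, HasDerivAt g (g' x) x)
    (hg' : ∀ᶠ x in atTop, g' x ≠ 0)
    (hgtop : Tendsto g atTop atTop)
    (hdiv : Tendsto (fun x => f' x / g' x) atTop (𝓝 l)) :
    Tendsto (fun x => f x / g x) atTop (𝓝 l) := by
  rw [Metric.tendsto_nhds]
  intro ε hε
  obtain ⟨N, hN⟩ := eventually_atTop.1 (hf.and (hg.and (hg'.and
    (Metric.tendsto_nhds.1 hdiv (ε / 2) (half_pos hε)))))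
  have hbound : ∀ᶠ x in atTop,
      |f N - l * g N| + ε / 2 * |g N| + 1 ≤ ε / 2 * g x :=
    (hgtop.const_mul_atTop (half_pos hε)).eventually_ge_atTop _
  filter_upwards [hbound, hgtop.eventually_gt_atTop 0, eventually_gt_atTop N] with x hb hgx hx
  obtain ⟨c, hc, hslope⟩ := exists_ratio_hasDerivAt_eq_ratio_slope f f' hx
    (fun y hy => (hN y hy.1).1.continuousAt.continuousWithinAt)
    (fun y hy => (hN y hy.1.le).1) g g'
    (fun y hy => (hN y hy.1).2.1.continuousAt.continuousWithinAt)
    (fun y hy => (hN y hy.1.le).2.1)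
  obtain ⟨-, -, hne, hd⟩ := hN c hc.1.le
  rw [Real.dist_eq] at hd ⊢
  have hincr : f x - f N = f' c / g' c * (g x - g N) := by
    field_simp
    linarith
  have hsplit : f x / g x - l =
      ((f' c / g' c - l) * (g x - g N) + (f N - l * g N)) / g x := by
    field_simp
    linarith
  rw [hsplit, abs_div, abs_of_pos hgx, div_lt_iff₀ hgx]
  have hprod : |(f' c / g' c - l) * (g x - g N)| ≤ ε / 2 * (g x + |g N|) := by
    rw [abs_mul]
    have habs := abs_sub (g x) (g N)
    rw [abs_of_pos hgx] at habs
    exact mul_le_mul hd.le habs (abs_nonneg _) (half_pos hε).le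
  linarith [abs_add_le ((f' c / g' c - l) * (g x - g N)) (f N - l * g N)]

/-- A function asymptotic to a nonzero multiple of `x ^ p` is regularly varying with index `p`. -/
theorem tendsto_comp_mul_div_of_tendsto_div_rpow {f : ℝ → ℝ} {p a : ℝ} (ha : a ≠ 0)
    (hf : Tendsto (fun x => f x / x ^ p) atTop (𝓝 a)) {c : ℝ} (hc : 0 < c) :
    Tendsto (fun x => f (c * x) / f x) atTop (𝓝 (c ^ p)) := by
  have hcomp := hf.comp (tendsto_id.const_mul_atTop hc)
  have hquot := (hcomp.div hf ha).const_mul (c ^ p)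
  rw [div_self ha, mul_one] at hquot
  refine hquot.congr' ?_
  filter_upwards [eventually_gt_atTop 0] with x hx
  have hcp := (Real.rpow_pos_of_pos hc p).ne'
  have hxp := (Real.rpow_pos_of_pos hx p).ne'
  simp only [Function.comp_apply, id, Pi.div_apply, Real.mul_rpow hc.le hx.le]
  field_simp

/-- For `p < 1`, `p ≠ 0`, and `U` increasing, concave on `(0,∞)`, differentiable
on `(M₀,∞)` with `U'(x)/x^(p-1) → 1` (and, if `p < 0`, additionally `U(x) → 0` as `x → ∞`),
the function `U` is regularly varying at infinity with index `p`:
`U(cx)/U(x) → c^p` as `x → ∞`, for every `c > 0`. -/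
theorem stmt2 (p : ℝ) (hp1 : p < 1) (hp0 : p ≠ 0)
    (U U' : ℝ → ℝ) (M₀ : ℝ) (hM₀ : 0 < M₀)
    (hmono : StrictMonoOn U (Set.Ioi 0))
    (hconc : ConcaveOn ℝ (Set.Ioi 0) U)
    (hderiv : ∀ x ∈ Set.Ioi M₀, HasDerivAt U (U' x) x)
    (hlim : Tendsto (fun x : ℝ => U' x / x ^ (p - 1)) atTop (𝓝 1))
    (hneg : p < 0 → Tendsto U atTop (𝓝 0)) :
    ∀ c > 0, Tendsto (fun x : ℝ => U (c * x) / U x) atTop (𝓝 (c ^ p)) := by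
  intro c hc
  refine tendsto_comp_mul_div_of_tendsto_div_rpow one_ne_zero ?_ hc (f := fun x => p * U x)
    |>.congr fun x => mul_div_mul_left _ _ hp0
  have hU : ∀ᶠ x in atTop, HasDerivAt U (U' x) x :=
    (eventually_gt_atTop M₀).mono hderiv
  have hG : ∀ᶠ x : ℝ in atTop, HasDerivAt (fun y : ℝ => y ^ p / p) (x ^ (p - 1)) x := by
    filter_upwards [eventually_gt_atTop 0] with x hx
    simpa [mul_div_cancel_left₀ _ hp0] using
      (Real.hasDerivAt_rpow_const (p := p) (Or.inl hx.ne')).div_const p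
  have hG' : ∀ᶠ x : ℝ in atTop, x ^ (p - 1) ≠ 0 :=
    (eventually_gt_atTop 0).mono fun x hx => (Real.rpow_pos_of_pos hx _).ne'
  have hratio : Tendsto (fun x : ℝ => U x / (x ^ p / p)) atTop (𝓝 1) := by
    rcases hp0.lt_or_gt with hp | hp
    · refine HasDerivAt.lhopital_zero_atTop hU hG hG' (hneg hp) ?_ hlim
      simpa using (tendsto_rpow_neg_atTop (neg_pos.2 hp)).div_const p
    · exact HasDerivAt.lhopital_atTop_atTop hU hG hG'
        ((tendsto_rpow_atTop hp).atTop_div_const hp) hlim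
  refine hratio.congr fun x => ?_
  rw [div_div_eq_mul_div, mul_comm]
end

section
/- Let p < 0 and let U : (0,∞) → ℝ be increasing, concave, and differentiable on (M₀,∞) for some M₀ > 0, with lim_{x→∞} U(x) = 0, lim_{x→∞} U'(x)/x^{p-1} = 1, and liminf_{x→0⁺} U(x)·x^{1-p} > -∞. Then the convex dual V(y) := sup_{x>0} (U(x) - x·y) satisfies -∞ < V(y) ≤ 0 for every y > 0; in particular the domain of finiteness of V is all of (0,∞). -/
open Filter Topology Set

/-- Let `p < 0` and `U` be increasing, concave on `(0,∞)`, differentiable on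
`(M₀,∞)`, with `U(x) → 0`, `U'(x)/x^(p-1) → 1` as `x → ∞`, and
`liminf_{x→0⁺} U(x)·x^(1-p) > -∞` (i.e. `U(x)·x^(1-p)` is eventually bounded below near `0`).
Then the convex dual `V(y) = sup_{x>0} (U(x) - x·y)` is finite (the sup is attained over a
set bounded above) and nonpositive for every `y > 0`; in particular `dom V = (0,∞)`. -/
theorem stmt5 (p : ℝ) (hp : p < 0)
    (U U' : ℝ → ℝ) (M₀ : ℝ) (hM₀ : 0 < M₀)
    (hmono : StrictMonoOn U (Set.Ioi 0))
    (hconc : ConcaveOn ℝ (Set.Ioi 0) U)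
    (hderiv : ∀ x ∈ Set.Ioi M₀, HasDerivAt U (U' x) x)
    (htop : Tendsto U atTop (𝓝 0))
    (hlim : Tendsto (fun x : ℝ => U' x / x ^ (p - 1)) atTop (𝓝 1))
    (hlow : ∃ C : ℝ, ∀ᶠ x in 𝓝[>] (0:ℝ), C ≤ U x * x ^ (1 - p)) :
    ∀ y > 0, BddAbove ((fun x => U x - x * y) '' Set.Ioi 0) ∧
      sSup ((fun x => U x - x * y) '' Set.Ioi 0) ≤ 0 := by
  have hU : ∀ x ∈ Set.Ioi (0 : ℝ), U x ≤ 0 := fun x hx =>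
    ge_of_tendsto htop <| by
      filter_upwards [eventually_ge_atTop x] with z hz
      exact hmono.monotoneOn hx (lt_of_lt_of_le hx hz) hz
  intro y hy
  have hV : ∀ v ∈ (fun x => U x - x * y) '' Set.Ioi 0, v ≤ 0 := by
    rintro _ ⟨x, hx, rfl⟩
    have hxy : 0 < x * y := mul_pos hx hy
    have hUx := hU x hx
    dsimp only
    linarith
  exact ⟨⟨0, hV⟩, Real.sSup_nonpos hV⟩
end

section
/- Let p < 1, p ≠ 0, and let U : (0,∞) → ℝ be increasing, concave, differentiable and strictly concave on (M₀,∞) for some M₀ > 0, with lim_{x→∞} U'(x)/x^{p-1} = 1; in the case p < 0 assume additionally lim_{x→∞} U(x) = 0 and liminf_{x→0⁺} U(x)·x^{1-p} > -∞, and in the case 0 < p < 1 assume U is bounded below. Let V(y) := sup_{x>0} (U(x) - x·y) and, for small y > 0, let I(y) = (U')^{-1}(y) be the inverse marginal utility. Then limsup_{y→0⁺} y·I(y)/V(y) < ∞, i.e., V satisfies the dual asymptotic elasticity condition. -/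
open Filter Topology Set

/-- If `U'` is asymptotically at least `c` times `x ^ (p - 1)`, then `U` is eventually at least
`c / p * x ^ p` up to an additive constant. -/
theorem exists_lower_bound_of_deriv_ratio {p c M : ℝ} (hp : p ≠ 0) {U U' : ℝ → ℝ}
    (hderiv : ∀ x ∈ Ioi M, HasDerivAt U (U' x) x) (hc : c < 1)
    (hlim : Tendsto (fun x : ℝ => U' x / x ^ (p - 1)) atTop (𝓝 1)) :
    ∃ K : ℝ, ∀ᶠ x : ℝ in atTop, c / p * x ^ p - K ≤ U x := by
  obtain ⟨a, ha⟩ := eventually_atTop.1 ((hlim.eventually_const_lt hc).and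
    ((eventually_gt_atTop M).and (eventually_gt_atTop 0)))
  have hd : ∀ x ∈ Ici a, HasDerivAt (fun x => U x - c / p * x ^ p)
      (U' x - c / p * (p * x ^ (p - 1))) x := fun x hx ↦
    (hderiv x (ha x hx).2.1).sub
      ((Real.hasDerivAt_rpow_const (Or.inl (ha x hx).2.2.ne')).const_mul _)
  have hmono : MonotoneOn (fun x => U x - c / p * x ^ p) (Ici a) := by
    refine monotoneOn_of_deriv_nonneg (convex_Ici a)
      (fun x hx ↦ (hd x hx).continuousAt.continuousWithinAt)
      (fun x hx ↦ (hd x (interior_subset hx)).differentiableAt.differentiableWithinAt)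
      fun x hx ↦ ?_
    have hx' := interior_subset hx
    obtain ⟨h, -, h0⟩ := ha x hx'
    rw [lt_div_iff₀ (Real.rpow_pos_of_pos h0 _)] at h
    rw [(hd x hx').deriv, ← mul_assoc, div_mul_cancel₀ _ hp]
    linarith
  refine ⟨-(U a - c / p * a ^ p), ?_⟩
  filter_upwards [eventually_ge_atTop a] with x hx
  have : U a - c / p * a ^ p ≤ U x - c / p * x ^ p := hmono self_mem_Ici hx hx
  linarith

/-- The inverse marginal utility of a concave function with power-like marginal utility tends to
infinity at `0`. -/
theorem tendsto_inverse_marginal {p M y₀ : ℝ} (hM : 0 < M) {U U' I : ℝ → ℝ}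
    (hconc : ConcaveOn ℝ (Ioi 0) U)
    (hderiv : ∀ x ∈ Ioi M, HasDerivAt U (U' x) x)
    (hlim : Tendsto (fun x : ℝ => U' x / x ^ (p - 1)) atTop (𝓝 1)) (hy₀ : 0 < y₀)
    (hI : ∀ y ∈ Ioo (0 : ℝ) y₀, I y ∈ Ioi M ∧ U' (I y) = y) :
    Tendsto I (𝓝[>] 0) atTop := by
  refine tendsto_atTop.2 fun b ↦ ?_
  obtain ⟨a, ha, hab, haM⟩ := ((hlim.eventually_const_lt one_pos).and
    ((eventually_ge_atTop b).and (eventually_gt_atTop M))).exists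
  have ha' : 0 < U' a := by
    rw [lt_div_iff₀ (Real.rpow_pos_of_pos (hM.trans haM) _)] at ha
    simpa using ha
  filter_upwards [Ioo_mem_nhdsGT hy₀, Ioo_mem_nhdsGT ha'] with y hy hya
  obtain ⟨hIM, hIy⟩ := hI y hy
  refine hab.trans (le_of_not_gt fun hlt ↦ ?_)
  have hle : U' a ≤ U' (I y) :=
    (hconc.le_slope_of_hasDerivAt (hM.trans hIM) (hM.trans haM) hlt (hderiv a haM)).trans
      (hconc.slope_le_of_hasDerivAt (hM.trans hIM) (hM.trans haM) hlt (hderiv _ hIM))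
  linarith [hya.2]

/-- Let `p < 1`, `p ≠ 0`, and `U` be increasing, concave on `(0,∞)`,
differentiable and strictly concave on `(M₀,∞)`, with `U'(x)/x^(p-1) → 1` as `x → ∞`;
if `p < 0` assume additionally `U(x) → 0` at infinity and `liminf_{x→0⁺} U(x)·x^(1-p) > -∞`,
and if `0 < p < 1` assume `U` is bounded below. Let `V(y) = sup_{x>0} (U(x) - x·y)` be the
convex dual, and for `0 < y < y₀` let `I(y)` be the inverse marginal utility
(`I(y) > M₀`, `U'(I(y)) = y`). Then `limsup_{y→0⁺} y·I(y)/V(y) < ∞`, i.e. `y·I(y)/V(y)` is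
eventually bounded above near `0` (the dual asymptotic elasticity condition). -/
theorem stmt6 (p : ℝ) (hp1 : p < 1) (hp0 : p ≠ 0)
    (U U' V I : ℝ → ℝ) (M₀ y₀ : ℝ) (hM₀ : 0 < M₀) (hy₀ : 0 < y₀)
    (hmono : StrictMonoOn U (Set.Ioi 0))
    (hconc : ConcaveOn ℝ (Set.Ioi 0) U)
    (hderiv : ∀ x ∈ Set.Ioi M₀, HasDerivAt U (U' x) x)
    (hstrict : StrictConcaveOn ℝ (Set.Ioi M₀) U)
    (hlim : Tendsto (fun x : ℝ => U' x / x ^ (p - 1)) atTop (𝓝 1))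
    (hneg : p < 0 →
      Tendsto U atTop (𝓝 0) ∧ ∃ C : ℝ, ∀ᶠ x in 𝓝[>] (0:ℝ), C ≤ U x * x ^ (1 - p))
    (hpos : 0 < p → ∃ C : ℝ, ∀ x > 0, C ≤ U x)
    (hV : ∀ y > 0, IsLUB ((fun x => U x - x * y) '' Set.Ioi 0) (V y))
    (hI : ∀ y ∈ Set.Ioo (0:ℝ) y₀, I y ∈ Set.Ioi M₀ ∧ U' (I y) = y) :
    ∃ C : ℝ, ∀ᶠ y in 𝓝[>] (0:ℝ), y * I y / V y ≤ C := by
  rcases lt_or_gt_of_ne hp0 with hp | hp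
  · have hU : ∀ x > 0, U x ≤ 0 := fun x hx ↦
      ge_of_tendsto (hneg hp).1 (by
        filter_upwards [eventually_ge_atTop x] with z hz
        exact hmono.monotoneOn hx (lt_of_lt_of_le hx hz) hz)
    refine ⟨0, ?_⟩
    filter_upwards [Ioo_mem_nhdsGT hy₀] with y hy
    have hIy : 0 < I y := hM₀.trans (hI y hy).1
    have hVy : V y ≤ 0 := (hV y hy.1).2 (by
      rintro _ ⟨x, hx, rfl⟩
      have hxy : 0 < x * y := mul_pos hx hy.1
      linarith [hU x hx])
    exact div_nonpos_of_nonneg_of_nonpos (mul_pos hy.1 hIy).le hVy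
  · have hε : 0 < (1 - p) / 4 := by linarith
    obtain ⟨K, hK⟩ := exists_lower_bound_of_deriv_ratio hp.ne' hderiv
      (show (1 - (1 - p) / 4) < 1 by linarith) hlim
    have hpow : ∀ᶠ x : ℝ in atTop, K ≤ (1 - p) / (4 * p) * x ^ p :=
      ((tendsto_rpow_atTop hp).const_mul_atTop
        (div_pos (by linarith) (by linarith))).eventually_ge_atTop K
    have hupper : ∀ᶠ x : ℝ in atTop, U' x / x ^ (p - 1) < 1 + (1 - p) / 4 :=
      hlim.eventually_lt_const (by linarith)
    refine ⟨8 * p / (1 - p), ?_⟩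
    filter_upwards [Ioo_mem_nhdsGT hy₀, (tendsto_inverse_marginal hM₀ hconc hderiv hlim hy₀ hI).eventually
      ((hK.and hpow).and hupper)] with y hy ⟨⟨hK, hpow⟩, hupper⟩
    obtain ⟨hIM, hIy⟩ := hI y hy
    have hI0 : 0 < I y := hM₀.trans hIM
    rw [hIy, div_lt_iff₀ (Real.rpow_pos_of_pos hI0 _)] at hupper
    have hmul : I y ^ (p - 1) * I y = I y ^ p := by
      rw [← Real.rpow_add_one hI0.ne']; ring_nf
    have hP : 0 < I y ^ p := Real.rpow_pos_of_pos hI0 p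
    have hyI : y * I y ≤ (1 + (1 - p) / 4) * I y ^ p := by
      rw [← hmul, ← mul_assoc]
      exact mul_le_mul_of_nonneg_right hupper.le hI0.le
    have hVy : U (I y) - I y * y ≤ V y := (hV y hy.1).1 ⟨I y, hI0, rfl⟩
    have hgap : (1 - p) / (4 * p) * I y ^ p ≤ V y := by
      have hcoef : 2 * ((1 - p) / (4 * p)) + (1 + (1 - p) / 4) ≤ (1 - (1 - p) / 4) / p := by
        rw [← sub_nonneg]
        have : (1 - (1 - p) / 4) / p - (2 * ((1 - p) / (4 * p)) + (1 + (1 - p) / 4))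
            = (1 - p) ^ 2 / (4 * p) := by
          field_simp
          ring
        rw [this]
        positivity
      nlinarith [mul_le_mul_of_nonneg_right hcoef hP.le]
    have hc : 0 < (1 - p) / (4 * p) := div_pos (by linarith) (by linarith)
    rw [div_le_iff₀ ((mul_pos hc hP).trans_le hgap)]
    have h8 : 8 * p / (1 - p) * ((1 - p) / (4 * p)) = 2 := by
      have : 1 - p ≠ 0 := by linarith
      field_simp
      norm_num
    have h8p : 0 ≤ 8 * p / (1 - p) := div_nonneg (by linarith) (by linarith)
    calc y * I y ≤ 2 * I y ^ p := hyI.trans (mul_le_mul_of_nonneg_right (by linarith) hP.le)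
      _ = 8 * p / (1 - p) * ((1 - p) / (4 * p) * I y ^ p) := by rw [← mul_assoc, h8]
      _ ≤ 8 * p / (1 - p) * V y := mul_le_mul_of_nonneg_left hgap h8p
end

section
/- Let (Ω, ℱ, ℙ) be a probability space and let X, Y be ℱ-measurable random variables with X > 0 and Y > 0 almost surely, E[X·Y] ≤ 1, and suppose E[X^p] and E[Y^q] are finite and strictly positive, where p < 1, p ≠ 0 and q = p/(p-1). Then (1/p)·E[X^p] = (1/p)·E[Y^q]^{1-p} holds if and only if E[X·Y] = 1 and X^{p-1} = α·Y almost surely for some constant α > 0. -/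
open Filter MeasureTheory

theorem rpow_div_lt_one_div_add_sub_one {p t : ℝ} (hp1 : p < 1) (hp0 : p ≠ 0) (ht : 0 < t)
    (ht1 : t ≠ 1) : t ^ p / p < 1 / p + (t - 1) := by
  rcases lt_or_gt_of_ne hp0 with hp | hp
  · have h := (Real.geom_mean_lt_arith_mean2_weighted_iff_of_pos
      (w₁ := -p / (1 - p)) (w₂ := 1 / (1 - p)) (p₁ := t) (p₂ := t ^ p)
      (div_pos (by linarith) (by linarith)) (div_pos one_pos (by linarith)) ht.le
      (Real.rpow_nonneg ht.le p)
      (by rw [← add_div, neg_add_eq_sub]; exact div_self (by linarith))).2 (by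
        intro h
        rcases lt_or_gt_of_ne ht1 with h1 | h1
        · have := Real.one_lt_rpow_of_pos_of_lt_one_of_neg ht h1 hp
          linarith
        · have := Real.rpow_lt_one_of_one_lt_of_neg h1 hp
          linarith)
    rw [← Real.rpow_mul ht.le, ← Real.rpow_add ht,
      show -p / (1 - p) + p * (1 / (1 - p)) = 0 by ring, Real.rpow_zero,
      show -p / (1 - p) * t + 1 / (1 - p) * t ^ p = (-p * t + t ^ p) / (1 - p) by ring,
      lt_div_iff₀ (by linarith)] at h
    rw [div_lt_iff_of_neg hp, add_mul, one_div_mul_cancel hp0]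
    linarith
  · have h := rpow_one_add_lt_one_add_mul_self (s := t - 1) (by linarith)
      (sub_ne_zero.2 ht1) hp hp1
    rw [add_sub_cancel] at h
    rw [div_lt_iff₀ hp, add_mul, one_div_mul_cancel hp0]
    linarith

/-- Strict tangent-line inequality for the power utility `x ↦ x ^ p / p`. -/
theorem rpow_div_lt_tangent {p x z : ℝ} (hp1 : p < 1) (hp0 : p ≠ 0) (hx : 0 < x)
    (hz : 0 < z) (hxz : x ≠ z) : x ^ p / p < z ^ p / p + z ^ (p - 1) * (x - z) := by
  have h := mul_lt_mul_of_pos_left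
    (rpow_div_lt_one_div_add_sub_one hp1 hp0 (div_pos hx hz)
      (fun h => hxz ((div_eq_one_iff_eq hz.ne').1 h))) (Real.rpow_pos_of_pos hz p)
  have hzp : z ^ p ≠ 0 := (Real.rpow_pos_of_pos hz p).ne'
  rw [Real.div_rpow hx.le hz.le] at h
  rw [Real.rpow_sub_one hz.ne']
  calc x ^ p / p = z ^ p * (x ^ p / z ^ p / p) := by field_simp
    _ < _ := h
    _ = _ := by field_simp

/-- Young-type inequality with conjugate exponents `p < 1` and `p / (p - 1)`. -/
theorem rpow_div_lt_of_rpow_sub_one_ne {p a b c : ℝ} (hp1 : p < 1) (hp0 : p ≠ 0)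
    (ha : 0 < a) (hb : 0 < b) (hc : 0 < c) (hne : a ^ (p - 1) ≠ c * b) :
    a ^ p / p < c * (a * b) + (1 / p - 1) * c ^ (p / (p - 1)) * b ^ (p / (p - 1)) := by
  have hp : p - 1 ≠ 0 := by linarith
  have hcb : 0 < c * b := mul_pos hc hb
  set z := (c * b) ^ (p - 1)⁻¹ with hz
  have hz0 : 0 < z := Real.rpow_pos_of_pos hcb _
  have hz1 : z ^ (p - 1) = c * b := Real.rpow_inv_rpow hcb.le hp
  have hzp : z ^ p = c ^ (p / (p - 1)) * b ^ (p / (p - 1)) := by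
    rw [hz, ← Real.rpow_mul hcb.le, ← Real.mul_rpow hc.le hb.le, inv_mul_eq_div]
  have hzz : z ^ (p - 1) * z = z ^ p := by
    rw [Real.rpow_sub_one hz0.ne', div_mul_cancel₀ _ hz0.ne']
  have h := rpow_div_lt_tangent hp1 hp0 ha hz0 (fun h => hne (h ▸ hz1))
  rw [mul_sub, hzz, hz1, hzp] at h
  linarith [show (1 / p - 1) * c ^ (p / (p - 1)) * b ^ (p / (p - 1)) =
    c ^ (p / (p - 1)) * b ^ (p / (p - 1)) / p - c ^ (p / (p - 1)) * b ^ (p / (p - 1)) by ring]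

theorem rpow_div_eq_of_rpow_sub_one_eq {p a b c : ℝ} (hp1 : p < 1) (ha : 0 < a) (hb : 0 < b) (hc : 0 < c) (heq : a ^ (p - 1) = c * b) :
    a ^ p / p = c * (a * b) + (1 / p - 1) * c ^ (p / (p - 1)) * b ^ (p / (p - 1)) := by
  have hp : p - 1 ≠ 0 := by linarith
  have h1 : c * (a * b) = a ^ p := by
    rw [mul_left_comm, ← heq, Real.rpow_sub_one ha.ne', mul_div_cancel₀ _ ha.ne']
  have h2 : c ^ (p / (p - 1)) * b ^ (p / (p - 1)) = a ^ p := by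
    rw [← Real.mul_rpow hc.le hb.le, ← heq, ← Real.rpow_mul ha.le, mul_div_cancel₀ _ hp]
  rw [mul_assoc, h1, h2]
  ring

/-- Equality case of the duality inequality: for `X, Y > 0` a.s. with
`E[X·Y] ≤ 1` and `E[X^p]`, `E[Y^q]` finite and strictly positive (`p < 1`, `p ≠ 0`,
`q = p/(p-1)`), one has `(1/p)·E[X^p] = (1/p)·E[Y^q]^(1-p)` if and only if `E[X·Y] = 1`
and `X^(p-1) = α·Y` a.s. for some `α > 0`. -/
theorem stmt8 {Ω : Type*} [MeasurableSpace Ω] (μ : Measure Ω) [IsProbabilityMeasure μ]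
    (X Y : Ω → ℝ) (p : ℝ) (hp1 : p < 1) (hp0 : p ≠ 0)
    (hX : ∀ᵐ ω ∂μ, 0 < X ω) (hY : ∀ᵐ ω ∂μ, 0 < Y ω)
    (hXYint : Integrable (fun ω => X ω * Y ω) μ)
    (hXY : ∫ ω, X ω * Y ω ∂μ ≤ 1)
    (hXp : Integrable (fun ω => X ω ^ p) μ)
    (hXppos : 0 < ∫ ω, X ω ^ p ∂μ)
    (hYq : Integrable (fun ω => Y ω ^ (p / (p - 1))) μ)
    (hYqpos : 0 < ∫ ω, Y ω ^ (p / (p - 1)) ∂μ) :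
    ((1 / p) * ∫ ω, X ω ^ p ∂μ =
        (1 / p) * (∫ ω, Y ω ^ (p / (p - 1)) ∂μ) ^ (1 - p)) ↔
      (∫ ω, X ω * Y ω ∂μ = 1 ∧
        ∃ α : ℝ, 0 < α ∧ ∀ᵐ ω ∂μ, X ω ^ (p - 1) = α * Y ω) := by
  set A := ∫ ω, X ω ^ p ∂μ with hA
  set B := ∫ ω, Y ω ^ (p / (p - 1)) ∂μ with hB
  have hp : p - 1 ≠ 0 := by linarith
  constructor
  · intro h
    have hAB : A = B ^ (1 - p) := mul_left_cancel₀ (one_div_ne_zero hp0) h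
    set c := B ^ (1 - p) with hc
    have hc0 : 0 < c := Real.rpow_pos_of_pos hYqpos _
    have hcB : c ^ (p / (p - 1)) * B = c := by
      rw [hc, ← Real.rpow_mul hYqpos.le, ← Real.rpow_add_one hYqpos.ne']
      congr 1
      field_simp
      ring
    set f : Ω → ℝ := fun ω => c * (X ω * Y ω) +
      (1 / p - 1) * c ^ (p / (p - 1)) * Y ω ^ (p / (p - 1)) - X ω ^ p / p with hf
    have hsum : Integrable (fun ω => c * (X ω * Y ω) +
        (1 / p - 1) * c ^ (p / (p - 1)) * Y ω ^ (p / (p - 1))) μ :=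
      (hXYint.const_mul _).add (hYq.const_mul _)
    have hfint : Integrable f μ := hsum.sub (hXp.div_const _)
    have hf0 : 0 ≤ᵐ[μ] f := by
      filter_upwards [hX, hY] with ω hx hy
      by_cases hxy : X ω ^ (p - 1) = c * Y ω
      · exact sub_nonneg.2 (rpow_div_eq_of_rpow_sub_one_eq hp1 hx hy hc0 hxy).le
      · exact sub_nonneg.2 (rpow_div_lt_of_rpow_sub_one_ne hp1 hp0 hx hy hc0 hxy).le
    have hfval : ∫ ω, f ω ∂μ = c * (∫ ω, X ω * Y ω ∂μ - 1) := by
      simp only [hf]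
      rw [integral_sub hsum (hXp.div_const _),
        integral_add (hXYint.const_mul _) (hYq.const_mul _), integral_const_mul,
        integral_const_mul, integral_div, ← hA, ← hB, mul_assoc (1 / p - 1), hcB, hAB]
      ring
    have hnonneg : 0 ≤ c * (∫ ω, X ω * Y ω ∂μ - 1) := hfval ▸ integral_nonneg_of_ae hf0
    have hE : ∫ ω, X ω * Y ω ∂μ = 1 :=
      le_antisymm hXY (sub_nonneg.1 (nonneg_of_mul_nonneg_right hnonneg hc0))
    refine ⟨hE, c, hc0, ?_⟩
    have hfz := (integral_eq_zero_iff_of_nonneg_ae hf0 hfint).1 (by rw [hfval, hE]; ring)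
    filter_upwards [hX, hY, hfz] with ω hx hy hω
    by_contra hxy
    exact (sub_pos.2 (rpow_div_lt_of_rpow_sub_one_ne hp1 hp0 hx hy hc0 hxy)).ne' hω
  · rintro ⟨hE, α, hα, h⟩
    have hAα : A = α := by
      have : A = ∫ ω, α * (X ω * Y ω) ∂μ := by
        refine integral_congr_ae ?_
        filter_upwards [hX, h] with ω hx hω
        rw [mul_left_comm, ← hω, Real.rpow_sub_one hx.ne', mul_div_cancel₀ _ hx.ne']
      rw [this, integral_const_mul, hE, mul_one]
    have hBα : α ^ (p / (p - 1)) * B = α := by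
      rw [← integral_const_mul]
      refine Eq.trans (integral_congr_ae ?_) hAα
      filter_upwards [hX, hY, h] with ω hx hy hω
      rw [← Real.mul_rpow hα.le hy.le, ← hω, ← Real.rpow_mul hx.le, mul_div_cancel₀ _ hp]
    have hB' : B = α ^ (1 - p / (p - 1)) := by
      rw [Real.rpow_sub hα, Real.rpow_one, eq_div_iff (Real.rpow_pos_of_pos hα _).ne', mul_comm,
        hBα]
    rw [hAα, hB', ← Real.rpow_mul hα.le,
      show (1 - p / (p - 1)) * (1 - p) = 1 by field_simp; ring, Real.rpow_one]
end

section
/- Let U : (0,∞) → ℝ be strictly increasing and continuous, differentiable on (M₀,∞) for some M₀ > 0, with lim_{x→∞} x·U'(x) = 1 and lim_{x→∞} U(x) = ∞. Then for every ε > 0 there exists M_ε > 0 such that for all a ≥ b ≥ M_ε: (1-ε)·(a-b) ≤ log( U⁻¹(a) / U⁻¹(b) ) ≤ (1+ε)·(a-b), where U⁻¹ denotes the inverse function of U. -/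
open Filter Topology Set

/-- A function with nonnegative derivative on `[K,∞)` is monotone there. -/
theorem monotoneOn_Ici_of_hasDerivAt_nonneg {f f' : ℝ → ℝ} {K : ℝ}
    (hf : ∀ x, K ≤ x → HasDerivAt f (f' x) x) (hf' : ∀ x, K ≤ x → 0 ≤ f' x) :
    MonotoneOn f (Set.Ici K) := by
  refine monotoneOn_of_deriv_nonneg (convex_Ici K)
    (fun x hx => (hf x hx).continuousAt.continuousWithinAt)
    (fun x hx => (hf x (interior_subset hx)).differentiableAt.differentiableWithinAt)
    (fun x hx => ?_)
  rw [(hf x (interior_subset hx)).deriv]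
  exact hf' x (interior_subset hx)

/-- Let `U` be strictly increasing and continuous on `(0,∞)`, differentiable on
`(M₀,∞)` with `x·U'(x) → 1` and `U(x) → ∞` as `x → ∞`, and let `Uinv` be the inverse of `U`
(defined on `[y₁,∞)` with values in `(0,∞)`). Then for every `ε > 0` there is `Mε > 0` such
that for all `a ≥ b ≥ Mε`: `(1-ε)·(a-b) ≤ log(Uinv a / Uinv b) ≤ (1+ε)·(a-b)`. -/
theorem stmt9 (U U' : ℝ → ℝ) (M₀ : ℝ) (hM₀ : 0 < M₀)
    (hmono : StrictMonoOn U (Set.Ioi 0))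
    (hcont : ContinuousOn U (Set.Ioi 0))
    (hderiv : ∀ x ∈ Set.Ioi M₀, HasDerivAt U (U' x) x)
    (hlim : Tendsto (fun x : ℝ => x * U' x) atTop (𝓝 1))
    (htop : Tendsto U atTop atTop)
    (Uinv : ℝ → ℝ) (y₁ : ℝ)
    (hUinv : ∀ y ≥ y₁, 0 < Uinv y ∧ U (Uinv y) = y) :
    ∀ ε > 0, ∃ Mε : ℝ, 0 < Mε ∧ ∀ a b : ℝ, Mε ≤ b → b ≤ a →
      (1 - ε) * (a - b) ≤ Real.log (Uinv a / Uinv b) ∧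
      Real.log (Uinv a / Uinv b) ≤ (1 + ε) * (a - b) := by
  intro ε hε
  have hlo : ∀ᶠ x in atTop, 1 < (1 + ε) * (x * U' x) :=
    (hlim.const_mul (1 + ε)).eventually (lt_mem_nhds (by linarith))
  have hup : ∀ᶠ x in atTop, (1 - ε) * (x * U' x) < 1 :=
    (hlim.const_mul (1 - ε)).eventually (gt_mem_nhds (by linarith))
  obtain ⟨K, hK⟩ := eventually_atTop.1 (hlo.and (hup.and (eventually_gt_atTop M₀)))
  have hK0 : 0 < K := hM₀.trans (hK K le_rfl).2.2
  have hU : ∀ x, K ≤ x → HasDerivAt U (U' x) x := fun x hx => hderiv x (hK x hx).2.2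
  have hlog : ∀ x, K ≤ x → HasDerivAt Real.log x⁻¹ x := fun x hx =>
    Real.hasDerivAt_log (hK0.trans_le hx).ne'
  have hmono_up : MonotoneOn (fun x => (1 + ε) * U x - Real.log x) (Set.Ici K) := by
    refine monotoneOn_Ici_of_hasDerivAt_nonneg
      (fun x hx => ((hU x hx).const_mul (1 + ε)).sub (hlog x hx)) fun x hx => ?_
    have hx0 : 0 < x := hK0.trans_le hx
    rw [sub_nonneg, inv_le_iff_one_le_mul₀ hx0]
    linarith [(hK x hx).1]
  have hmono_lo : MonotoneOn (fun x => Real.log x - (1 - ε) * U x) (Set.Ici K) := by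
    refine monotoneOn_Ici_of_hasDerivAt_nonneg
      (fun x hx => (hlog x hx).sub ((hU x hx).const_mul (1 - ε))) fun x hx => ?_
    have hx0 : 0 < x := hK0.trans_le hx
    rw [sub_nonneg, ← one_div, le_div_iff₀ hx0]
    linarith [(hK x hx).2.1]
  refine ⟨max 1 (max y₁ (U K)), by positivity, fun a b hb hab => ?_⟩
  simp only [max_le_iff] at hb
  obtain ⟨-, hby, hbK⟩ := hb
  obtain ⟨hb0, hUb⟩ := hUinv b hby
  obtain ⟨ha0, hUa⟩ := hUinv a (hby.trans hab)
  have hKb : K ≤ Uinv b := (hmono.le_iff_le hK0 hb0).1 (by rwa [hUb])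
  have hba : Uinv b ≤ Uinv a := (hmono.le_iff_le hb0 ha0).1 (by rwa [hUa, hUb])
  have h₁ := hmono_up hKb (hKb.trans hba) hba
  have h₂ := hmono_lo hKb (hKb.trans hba) hba
  simp only [hUa, hUb] at h₁ h₂
  rw [Real.log_div ha0.ne' hb0.ne']
  constructor <;> linarith
end

section
/- Let p < 0 and let U : (0,∞) → ℝ be increasing with U(x) < 0 for all x and lim_{x→∞} U(cx)/U(x) = c^p for every c > 0. Let (a_n) and (b_n) be sequences with a_n ≥ b_n > 0 for all n, lim_{n→∞} b_n = ∞, and lim_{n→∞} U(a_n)/U(b_n) = 1. Then lim_{n→∞} a_n/b_n = 1. -/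
open Filter Topology Set

/-- Let `p < 0` and `U` be increasing, everywhere negative on `(0,∞)`, and
regularly varying at infinity with index `p`. If `a_n ≥ b_n > 0`, `b_n → ∞`, and
`U(a_n)/U(b_n) → 1`, then `a_n/b_n → 1`. -/
theorem stmt11 (p : ℝ) (hp : p < 0) (U : ℝ → ℝ)
    (hmono : MonotoneOn U (Set.Ioi 0))
    (hneg : ∀ x > 0, U x < 0)
    (hrv : ∀ c > 0, Tendsto (fun x : ℝ => U (c * x) / U x) atTop (𝓝 (c ^ p)))
    (a b : ℕ → ℝ) (hab : ∀ n, b n ≤ a n) (hbpos : ∀ n, 0 < b n)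
    (hb : Tendsto b atTop atTop)
    (hU : Tendsto (fun n => U (a n) / U (b n)) atTop (𝓝 1)) :
    Tendsto (fun n => a n / b n) atTop (𝓝 1) := by
  refine tendsto_order.2 ⟨fun c hc => ?_, fun c hc => ?_⟩
  · exact Eventually.of_forall fun n => hc.trans_le ((one_le_div (hbpos n)).2 (hab n))
  · have hc0 : 0 < c := one_pos.trans hc
    have hlt := ((hrv c hc0).comp hb).eventually_lt hU
      (Real.rpow_lt_one_of_one_lt_of_neg hc hp)
    filter_upwards [hlt] with n hn
    rw [div_lt_iff₀ (hbpos n)]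
    by_contra! hle
    have hcb : 0 < c * b n := mul_pos hc0 (hbpos n)
    have hUle : U (c * b n) ≤ U (a n) := hmono hcb (hcb.trans_le hle) hle
    exact hn.not_ge (div_le_div_of_nonpos_of_le (hneg _ (hbpos n)).le hUle)
end

section
/- Let (Ω, ℱ, ℙ) be a probability space, let p < 1, and let ξ, η be random variables with ξ > 0 and η ≥ L almost surely for a constant L > 0. Suppose 0 < E[ξ^p] < ∞ and E[ξ^{p-1}·η] ≤ E[ξ^p]. Then for every N > 0: E[ξ^p·1_{\{ξ ≤ N\}}] ≤ (N/L)·E[ξ^p]. In particular, under the probability measure ℙ^ξ with density ξ^p/E[ξ^p] relative to ℙ, one has ℙ^ξ(ξ ≤ N) ≤ N/L. -/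
open Filter MeasureTheory

/-- Let `p < 1`, `ξ > 0` a.s., `η ≥ L > 0` a.s., with `0 < E[ξ^p] < ∞` and
`E[ξ^(p-1)·η] ≤ E[ξ^p]`. Then for every `N > 0`,
`E[ξ^p·1_{ξ ≤ N}] ≤ (N/L)·E[ξ^p]`; in particular, under the measure with density
`ξ^p/E[ξ^p]` relative to `ℙ`, the event `{ξ ≤ N}` has measure at most `N/L`. -/
theorem stmt12 {Ω : Type*} [MeasurableSpace Ω] (μ : Measure Ω) [IsProbabilityMeasure μ]
    (p : ℝ) (hp : p < 1) (ξ η : Ω → ℝ) (L : ℝ) (hL : 0 < L)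
    (hξm : Measurable ξ)
    (hξ : ∀ᵐ ω ∂μ, 0 < ξ ω) (hη : ∀ᵐ ω ∂μ, L ≤ η ω)
    (hint1 : Integrable (fun ω => ξ ω ^ p) μ)
    (hpos : 0 < ∫ ω, ξ ω ^ p ∂μ)
    (hint2 : Integrable (fun ω => ξ ω ^ (p - 1) * η ω) μ)
    (hineq : ∫ ω, ξ ω ^ (p - 1) * η ω ∂μ ≤ ∫ ω, ξ ω ^ p ∂μ) :
    ∀ N > 0,
      (∫ ω in {ω | ξ ω ≤ N}, ξ ω ^ p ∂μ ≤ (N / L) * ∫ ω, ξ ω ^ p ∂μ) ∧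
      μ.withDensity (fun ω => ENNReal.ofReal (ξ ω ^ p / ∫ ω' , ξ ω' ^ p ∂μ))
          {ω | ξ ω ≤ N} ≤ ENNReal.ofReal (N / L) := by
  intro N hN
  have hset : MeasurableSet {ω | ξ ω ≤ N} := measurableSet_le hξm measurable_const
  have hbound : ∫ ω in {ω | ξ ω ≤ N}, ξ ω ^ p ∂μ ≤ (N / L) * ∫ ω, ξ ω ^ p ∂μ := by
    calc ∫ ω in {ω | ξ ω ≤ N}, ξ ω ^ p ∂μ
        ≤ ∫ ω in {ω | ξ ω ≤ N}, (N / L) * (ξ ω ^ (p - 1) * η ω) ∂μ := by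
          refine setIntegral_mono_on_ae hint1.integrableOn
            (hint2.const_mul _).integrableOn hset ?_
          filter_upwards [hξ, hη] with ω hω hηω hωN
          have hωN : ξ ω ≤ N := hωN
          have hpow : ξ ω ^ p = ξ ω ^ (p - 1) * ξ ω := by
            rw [← Real.rpow_add_one hω.ne', sub_add_cancel]
          have hle : ξ ω ≤ (N / L) * η ω := by
            calc ξ ω ≤ (N / L) * L := by rwa [div_mul_cancel₀ N hL.ne']
              _ ≤ (N / L) * η ω := by gcongr
          calc ξ ω ^ p = ξ ω ^ (p - 1) * ξ ω := hpow
            _ ≤ ξ ω ^ (p - 1) * ((N / L) * η ω) := by gcongr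
            _ = (N / L) * (ξ ω ^ (p - 1) * η ω) := by ring
      _ ≤ ∫ ω, (N / L) * (ξ ω ^ (p - 1) * η ω) ∂μ := by
          refine setIntegral_le_integral (hint2.const_mul _) ?_
          filter_upwards [hξ, hη] with ω hω hηω
          have : 0 < η ω := hL.trans_le hηω
          simp only [Pi.zero_apply]
          positivity
      _ = (N / L) * ∫ ω, ξ ω ^ (p - 1) * η ω ∂μ := integral_const_mul _ _
      _ ≤ (N / L) * ∫ ω, ξ ω ^ p ∂μ := by gcongr
  refine ⟨hbound, ?_⟩
  rw [withDensity_apply _ hset, ← ofReal_integral_eq_lintegral_ofReal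
    (hint1.div_const _).integrableOn, integral_div]
  · exact ENNReal.ofReal_le_ofReal ((div_le_iff₀ hpos).2 hbound)
  · filter_upwards [ae_restrict_of_ae hξ] with ω hω
    simp only [Pi.zero_apply]
    positivity
end

section
/- Let f : ℝ → ℝ be twice continuously differentiable on (0,∞), let S > 0 and K̄ > 0. Then f(S) = f(K̄) + f'(K̄)·(S - K̄) + ∫₀^{K̄} f''(k)·max(k - S, 0) dk + ∫_{K̄}^{∞} f''(k)·max(S - k, 0) dk, where both integrals are over bounded sets since the integrands vanish for k outside the interval between S and K̄. -/
open Filter MeasureTheory Set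

/-- Second-order Taylor expansion on `(0,∞)` with integral remainder. -/
theorem integral_second_deriv_mul_sub {f f' f'' : ℝ → ℝ}
    (hf' : ∀ x ∈ Set.Ioi (0:ℝ), HasDerivAt f (f' x) x)
    (hf'' : ∀ x ∈ Set.Ioi (0:ℝ), HasDerivAt f' (f'' x) x)
    (hcont : ContinuousOn f'' (Set.Ioi 0)) {a b : ℝ} (ha : 0 < a) (hb : 0 < b) :
    ∫ k in a..b, f'' k * (b - k) = f b - f a - f' a * (b - a) := by
  have hsub : Set.uIcc a b ⊆ Set.Ioi 0 := fun x hx => lt_of_lt_of_le (lt_min ha hb) hx.1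
  have hderiv : ∀ x ∈ Set.uIcc a b,
      HasDerivAt (fun k => f k + f' k * (b - k)) (f'' x * (b - x)) x := fun x hx => by
    refine ((hf' x (hsub hx)).add
      ((hf'' x (hsub hx)).mul ((hasDerivAt_id x).const_sub b))).congr_deriv ?_
    simp only [id_eq]
    ring
  have hint : IntervalIntegrable (fun k => f'' k * (b - k)) volume a b :=
    ((hcont.mono hsub).mul (by fun_prop)).intervalIntegrable
  rw [intervalIntegral.integral_eq_sub_of_hasDerivAt hderiv hint]
  ring

/-- Carr–Madan static replication: for `f` twice continuously differentiable
on `(0,∞)` and `S, K̄ > 0`: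
`f(S) = f(K̄) + f'(K̄)(S - K̄) + ∫₀^K̄ f''(k)(k-S)⁺ dk + ∫_K̄^∞ f''(k)(S-k)⁺ dk`. -/
theorem stmt13 (f f' f'' : ℝ → ℝ)
    (hf' : ∀ x ∈ Set.Ioi (0:ℝ), HasDerivAt f (f' x) x)
    (hf'' : ∀ x ∈ Set.Ioi (0:ℝ), HasDerivAt f' (f'' x) x)
    (hcont : ContinuousOn f'' (Set.Ioi 0))
    (S Kbar : ℝ) (hS : 0 < S) (hK : 0 < Kbar) :
    f S = f Kbar + f' Kbar * (S - Kbar)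
      + (∫ k in Set.Ioc (0:ℝ) Kbar, f'' k * max (k - S) 0)
      + (∫ k in Set.Ioi Kbar, f'' k * max (S - k) 0) := by
  have taylor := integral_second_deriv_mul_sub hf' hf'' hcont hK hS
  rcases le_total Kbar S with h | h
  · have hput : ∫ k in Set.Ioc (0:ℝ) Kbar, f'' k * max (k - S) 0 = 0 :=
      setIntegral_eq_zero_of_forall_eq_zero fun k hk => by
        rw [max_eq_right (by linarith [hk.2]), mul_zero]
    have hcall : ∫ k in Set.Ioi Kbar, f'' k * max (S - k) 0
        = ∫ k in Kbar..S, f'' k * (S - k) := by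
      rw [intervalIntegral.integral_of_le h,
        setIntegral_eq_of_subset_of_forall_sdiff_eq_zero measurableSet_Ioi
          (Set.Ioc_subset_Ioi_self : Set.Ioc Kbar S ⊆ Set.Ioi Kbar)]
      · refine setIntegral_congr_fun measurableSet_Ioc fun k hk => ?_
        simp only [max_eq_left (sub_nonneg.2 hk.2)]
      · intro k hk
        have hSk : S < k := not_le.1 fun hle => hk.2 ⟨hk.1, hle⟩
        rw [max_eq_right (by linarith), mul_zero]
    rw [hput, hcall, taylor]
    ring
  · have hcall : ∫ k in Set.Ioi Kbar, f'' k * max (S - k) 0 = 0 :=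
      setIntegral_eq_zero_of_forall_eq_zero fun k hk => by
        rw [max_eq_right (by linarith [Set.mem_Ioi.1 hk]), mul_zero]
    have hput : ∫ k in Set.Ioc (0:ℝ) Kbar, f'' k * max (k - S) 0
        = ∫ k in Kbar..S, f'' k * (S - k) := by
      rw [intervalIntegral.integral_of_ge h, ← integral_neg,
        setIntegral_eq_of_subset_of_forall_sdiff_eq_zero measurableSet_Ioc
          (Set.Ioc_subset_Ioc_left hS.le)]
      · refine setIntegral_congr_fun measurableSet_Ioc fun k hk => ?_
        simp only [max_eq_left (sub_nonneg.2 hk.1.le)]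
        ring
      · intro k hk
        have hkS : k ≤ S := not_lt.1 fun hlt => hk.2 ⟨hlt, hk.1.2⟩
        rw [max_eq_right (by linarith), mul_zero]
    rw [hput, hcall, taylor]
    ring
end

section
/- Let (Ω, ℱ, ℙ) be a probability space and let (a_n), (r_n) be sequences of random variables with a_n > 0 and r_n > 0 almost surely, such that for every n the random variable (1 - a_n/r_n)·(r_n - 1) is integrable with E[(1 - a_n/r_n)·(r_n - 1)] ≤ 0, and lim_{n→∞} E[|a_n - 1|] = 0. Then lim_{n→∞} E[ |1 - a_n/r_n| · |r_n - 1| ] = 0. -/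
open Filter Topology MeasureTheory

/-- The negative part of `(1 - a / r) * (r - 1)` is at most `|a - 1|`. -/
lemma abs_mul_abs_le_mul_add_two_mul_abs_sub_one {a r : ℝ} (ha : 0 < a) (hr : 0 < r) :
    |1 - a / r| * |r - 1| ≤ (1 - a / r) * (r - 1) + 2 * |a - 1| := by
  obtain ⟨q, hq, rfl⟩ : ∃ q, 0 < q ∧ a = q * r :=
    ⟨a / r, div_pos ha hr, (div_mul_cancel₀ a hr.ne').symm⟩
  rw [mul_div_cancel_right₀ q hr.ne', ← abs_mul]
  have hle := le_abs_self (q * r - 1)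
  have hge := neg_abs_le (q * r - 1)
  rcases le_total 0 ((1 - q) * (r - 1)) with h | h
  · rw [abs_of_nonneg h]
    linarith [abs_nonneg (q * r - 1)]
  · rw [abs_of_nonpos h]
    rcases le_total q 1 with hq1 | hq1 <;> rcases le_total r 1 with hr1 | hr1
    · nlinarith [mul_nonneg hq.le (sub_nonneg.2 hr1), mul_nonneg hr.le (sub_nonneg.2 hq1)]
    · nlinarith [mul_nonneg (sub_nonneg.2 hq1) (sub_nonneg.2 hr1), abs_nonneg (q * r - 1)]
    · nlinarith [mul_nonneg (sub_nonneg.2 hq1) (sub_nonneg.2 hr1), abs_nonneg (q * r - 1)]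
    · nlinarith

/-- If `a_n > 0` and `r_n > 0` a.s., the random variables
`(1 - a_n/r_n)·(r_n - 1)` are integrable with `E[(1 - a_n/r_n)·(r_n - 1)] ≤ 0`, and
`E[|a_n - 1|] → 0`, then `E[|1 - a_n/r_n|·|r_n - 1|] → 0`. -/
theorem stmt17 {Ω : Type*} [MeasurableSpace Ω] (μ : Measure Ω) [IsProbabilityMeasure μ]
    (a r : ℕ → Ω → ℝ)
    (ha : ∀ n, ∀ᵐ ω ∂μ, 0 < a n ω) (hr : ∀ n, ∀ᵐ ω ∂μ, 0 < r n ω)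
    (hint : ∀ n, Integrable (fun ω => (1 - a n ω / r n ω) * (r n ω - 1)) μ)
    (hneg : ∀ n, ∫ ω, (1 - a n ω / r n ω) * (r n ω - 1) ∂μ ≤ 0)
    (hainta : ∀ n, Integrable (fun ω => |a n ω - 1|) μ)
    (haconv : Tendsto (fun n => ∫ ω, |a n ω - 1| ∂μ) atTop (𝓝 0)) :
    Tendsto (fun n => ∫ ω, |1 - a n ω / r n ω| * |r n ω - 1| ∂μ) atTop (𝓝 0) := by
  refine squeeze_zero (g := fun n => 2 * ∫ ω, |a n ω - 1| ∂μ)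
    (fun n => integral_nonneg fun ω => by positivity) (fun n => ?_)
    (by simpa using haconv.const_mul 2)
  calc ∫ ω, |1 - a n ω / r n ω| * |r n ω - 1| ∂μ
      ≤ ∫ ω, ((1 - a n ω / r n ω) * (r n ω - 1) + 2 * |a n ω - 1|) ∂μ := by
        refine integral_mono_ae ?_ ((hint n).add ((hainta n).const_mul 2)) ?_
        · simpa only [abs_mul] using (hint n).abs
        · filter_upwards [ha n, hr n] with ω h₁ h₂
          exact abs_mul_abs_le_mul_add_two_mul_abs_sub_one h₁ h₂
    _ = ∫ ω, (1 - a n ω / r n ω) * (r n ω - 1) ∂μ + 2 * ∫ ω, |a n ω - 1| ∂μ := by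
        rw [integral_add (hint n) ((hainta n).const_mul 2), integral_const_mul]
    _ ≤ 2 * ∫ ω, |a n ω - 1| ∂μ := by linarith [hneg n]
end

section
/- Let (Ω, ℱ, ℙ) be a probability space and let (a_n), (r_n) be sequences of random variables with a_n > 0 and r_n > 0 almost surely, such that a_n → 1 in probability and (1 - a_n/r_n)·(1 - r_n) → 0 in probability. Then r_n → 1 in probability. -/
open Filter Topology MeasureTheory

/-- If `a` is within `ε / 2` of `1` and `r > 0` is at distance at least `ε` from `1`, then
`(1 - a / r) * (1 - r)` is bounded away from `0`. -/
lemma le_abs_one_sub_div_mul_one_sub {a r ε : ℝ} (hε : 0 < ε) (hr : 0 < r)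
    (ha : |a - 1| < ε / 2) (h : ε ≤ |r - 1|) :
    ε ^ 2 / (2 * (1 + ε)) ≤ |(1 - a / r) * (1 - r)| := by
  have hprod : |(1 - a / r) * (1 - r)| = |r - a| * |r - 1| / r := by
    rw [abs_mul, abs_sub_comm 1 r, one_sub_div hr.ne', abs_div, abs_of_pos hr, div_mul_eq_mul_div]
  have hra : |r - 1| / 2 ≤ |r - a| := by
    have := abs_sub_le r a 1
    linarith
  have hr1 : r ≤ 1 + |r - 1| := by linarith [le_abs_self (r - 1)]
  rw [hprod, div_le_div_iff₀ (by positivity) hr]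
  generalize |r - 1| = t at *
  have ht : 0 ≤ t := hε.le.trans h
  calc ε ^ 2 * r ≤ ε ^ 2 * (1 + t) := by gcongr
    _ ≤ t ^ 2 * (1 + ε) := by
      nlinarith [mul_nonneg (mul_nonneg hε.le ht) (sub_nonneg.2 h), pow_le_pow_left₀ hε.le h 2]
    _ = t / 2 * t * (2 * (1 + ε)) := by ring
    _ ≤ |r - a| * t * (2 * (1 + ε)) := by gcongr

/-- If `a_n > 0` and `r_n > 0` a.s., `a_n → 1` in probability, and
`(1 - a_n/r_n)·(1 - r_n) → 0` in probability, then `r_n → 1` in probability. -/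
theorem stmt18 {Ω : Type*} [MeasurableSpace Ω] (μ : Measure Ω) [IsProbabilityMeasure μ]
    (a r : ℕ → Ω → ℝ)
    (ha : ∀ n, ∀ᵐ ω ∂μ, 0 < a n ω) (hr : ∀ n, ∀ᵐ ω ∂μ, 0 < r n ω)
    (haconv : TendstoInMeasure μ a atTop (fun _ => (1:ℝ)))
    (hprod : TendstoInMeasure μ
      (fun n ω => (1 - a n ω / r n ω) * (1 - r n ω)) atTop (fun _ => (0:ℝ))) :
    TendstoInMeasure μ r atTop (fun _ => (1:ℝ)) := by
  rw [tendstoInMeasure_iff_norm] at haconv hprod ⊢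
  intro ε hε
  have hsum := (haconv (ε / 2) (by positivity)).add
    (hprod (ε ^ 2 / (2 * (1 + ε))) (by positivity))
  rw [add_zero] at hsum
  refine tendsto_of_tendsto_of_tendsto_of_le_of_le tendsto_const_nhds hsum
    (fun _ => zero_le) fun n => ?_
  refine (measure_mono_ae ?_).trans (measure_union_le _ _)
  filter_upwards [hr n] with ω hω h
  rcases le_or_gt (ε / 2) |a n ω - 1| with h1 | h1
  · exact Or.inl h1
  · refine Or.inr ?_
    simpa only [Set.mem_ofPred_eq, sub_zero, Real.norm_eq_abs] using
      le_abs_one_sub_div_mul_one_sub hε hω h1 h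
end

section
/- Let r > 0, μ > 0, σ > 0, p < 0 and p* < p - 1 satisfy (μ/(σ²(1-p)))² > 2·max{1, 1/(p - p* - 1)}·r/σ². For T > 0 let W_T be a random variable with the centered Gaussian distribution of variance T, and set X̃_T = exp( (r + (1-2p)·μ²/(2(1-p)²·σ²))·T + (μ/((1-p)·σ))·W_T ). Then lim_{T→∞} E[ X̃_T^{p*} · 1_{\{X̃_T ≤ 1\}} ] / E[ X̃_T^{p} ] = ∞. -/
open Filter Topology MeasureTheory ProbabilityTheory

/-- The optimal isoelastic wealth in the Black–Scholes model with safe rate `r`, excess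
return `μ`, volatility `σ`, and risk-aversion parameter `p`, at horizon `T`, as a function
of the Brownian value `w`:
`X̃_T = exp((r + (1-2p)μ²/(2(1-p)²σ²))T + (μ/((1-p)σ))·w)`. -/
noncomputable def tildeX (r μ σ p T w : ℝ) : ℝ :=
  Real.exp ((r + (1 - 2 * p) * μ ^ 2 / (2 * (1 - p) ^ 2 * σ ^ 2)) * T
    + (μ / ((1 - p) * σ)) * w)

/-- Powers of the wealth process are exponentials of an affine function of the Brownian value. -/
lemma tildeX_rpow (r μ σ p T w q : ℝ) :
    tildeX r μ σ p T w ^ q =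
      Real.exp (q * ((r + (1 - 2 * p) * μ ^ 2 / (2 * (1 - p) ^ 2 * σ ^ 2)) * T)) *
        Real.exp (q * (μ / ((1 - p) * σ)) * w) := by
  rw [tildeX, ← Real.exp_mul, ← Real.exp_add]
  ring_nf

lemma integrable_tildeX_rpow (r μ σ p T q : ℝ) :
    Integrable (fun w => tildeX r μ σ p T w ^ q) (gaussianReal 0 T.toNNReal) := by
  simp_rw [tildeX_rpow]
  exact (integrable_exp_mul_gaussianReal _).const_mul _

lemma integral_tildeX_rpow (r μ σ p q : ℝ) {T : ℝ} (hT : 0 ≤ T) :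
    ∫ w, tildeX r μ σ p T w ^ q ∂(gaussianReal 0 T.toNNReal) =
      Real.exp ((q * (r + (1 - 2 * p) * μ ^ 2 / (2 * (1 - p) ^ 2 * σ ^ 2))
        + q ^ 2 * (μ / ((1 - p) * σ)) ^ 2 / 2) * T) := by
  simp_rw [tildeX_rpow]
  have h := congrFun (mgf_fun_id_gaussianReal (μ := 0) (v := T.toNNReal))
    (q * (μ / ((1 - p) * σ)))
  rw [mgf] at h
  rw [integral_const_mul, h, ← Real.exp_add, Real.coe_toNNReal T hT]
  ring_nf

/-- Above wealth `1` the smaller power is dominated by the larger one. -/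
lemma integral_rpow_sub_le_integral_indicator (r μ σ p T : ℝ) {q s : ℝ} (hqs : q ≤ s) :
    (∫ w, tildeX r μ σ p T w ^ q ∂(gaussianReal 0 T.toNNReal)) -
        ∫ w, tildeX r μ σ p T w ^ s ∂(gaussianReal 0 T.toNNReal) ≤
      ∫ w, Set.indicator {w' : ℝ | tildeX r μ σ p T w' ≤ 1}
        (fun w' => tildeX r μ σ p T w' ^ q) w ∂(gaussianReal 0 T.toNNReal) := by
  have hq := integrable_tildeX_rpow r μ σ p T q
  have hs := integrable_tildeX_rpow r μ σ p T s
  have hmeas : MeasurableSet {w' : ℝ | tildeX r μ σ p T w' ≤ 1} := by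
    refine measurableSet_le ?_ measurable_const
    unfold tildeX
    fun_prop
  rw [← integral_sub hq hs]
  refine integral_mono (hq.sub hs) (hq.indicator hmeas) fun w => ?_
  have hpos : 0 < tildeX r μ σ p T w := Real.exp_pos _
  by_cases hw : tildeX r μ σ p T w ≤ 1
  · rw [Set.indicator_of_mem (by exact hw)]
    simpa using (Real.rpow_pos_of_pos hpos s).le
  · rw [Set.indicator_of_notMem (by exact hw)]
    exact sub_nonpos.2 (Real.rpow_le_rpow_of_exponent_le (not_le.1 hw).le hqs)

/-- in the Black–Scholes model with `r, μ, σ > 0`, `p < 0`, `p* < p - 1` and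
`(μ/(σ²(1-p)))² > 2·max{1, 1/(p-p*-1)}·r/σ²`, with `W_T ~ N(0,T)`,
`E[X̃_T^{p*}·1_{X̃_T ≤ 1}] / E[X̃_T^p] → ∞` as `T → ∞`. -/
theorem stmt19 (r μ σ p pstar : ℝ) (hr : 0 < r) (hμ : 0 < μ) (hσ : 0 < σ)
    (hp : p < 0) (hps : pstar < p - 1)
    (hpar : (μ / (σ ^ 2 * (1 - p))) ^ 2 > 2 * max 1 (1 / (p - pstar - 1)) * r / σ ^ 2) :
    Tendsto (fun T : ℝ =>
      (∫ w, Set.indicator {w' : ℝ | tildeX r μ σ p T w' ≤ 1}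
          (fun w' => tildeX r μ σ p T w' ^ pstar) w
        ∂(gaussianReal 0 T.toNNReal)) /
      (∫ w, tildeX r μ σ p T w ^ p ∂(gaussianReal 0 T.toNNReal)))
      atTop atTop := by
  set m : ℝ := (μ / ((1 - p) * σ)) ^ 2 with hm
  have h1p : 0 < 1 - p := by linarith
  have hd : 0 < p - pstar - 1 := by linarith
  have hmr : 2 * r < (p - pstar - 1) * m := by
    have h1 : 2 * max 1 (1 / (p - pstar - 1)) * r < m := by
      have h2 : (μ / (σ ^ 2 * (1 - p))) ^ 2 = m / σ ^ 2 := by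
        rw [hm]
        field_simp
      rw [h2] at hpar
      exact (div_lt_div_iff_of_pos_right (by positivity)).1 hpar
    have h3 : 2 * (1 / (p - pstar - 1)) * r < m :=
      lt_of_le_of_lt (by gcongr; exact le_max_right _ _) h1
    calc 2 * r = (p - pstar - 1) * (2 * (1 / (p - pstar - 1)) * r) := by field_simp
      _ < _ := by gcongr
  set a : ℝ := r + (1 - 2 * p) * μ ^ 2 / (2 * (1 - p) ^ 2 * σ ^ 2) with ha
  have ham : a = r + (1 - 2 * p) * m / 2 := by
    rw [ha, hm]
    field_simp
  set c : ℝ := (pstar * a + pstar ^ 2 * m / 2) - (p * a + p ^ 2 * m / 2) with hc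
  have hcpos : 0 < c := by
    have h : c = (p - pstar) * (((p - pstar - 1) * m - 2 * r) / 2) := by
      rw [hc, ham]
      ring
    rw [h]
    exact mul_pos (by linarith) (by linarith)
  have hlim : Tendsto (fun T : ℝ => Real.exp (c * T) - 1) atTop atTop :=
    tendsto_atTop_add_const_right _ _
      (Real.tendsto_exp_atTop.comp (tendsto_id.const_mul_atTop hcpos))
  refine tendsto_atTop_mono' _ ?_ hlim
  filter_upwards [eventually_ge_atTop 0] with T hT
  have hle := integral_rpow_sub_le_integral_indicator r μ σ p T
    (show pstar ≤ p by linarith)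
  rw [integral_tildeX_rpow r μ σ p p hT] at hle ⊢
  rw [integral_tildeX_rpow r μ σ p pstar hT] at hle
  rw [le_div_iff₀ (Real.exp_pos _)]
  refine le_trans (le_of_eq ?_) hle
  rw [sub_mul, one_mul, ← Real.exp_add, ← add_mul, hc, sub_add_cancel]
end
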